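/- Let (G,X) be a G-family of quandles. Then the operation on G × X given by (g,x) ▷ (h,y) = (h⁻¹gh, x ▷^h y) is right self-distributive: ((a ▷ b) ▷ c) = ((a ▷ c) ▷ (b ▷ c)) for all a, b, c ∈ G × X. Consequently A(G,X) is a quandle. -/

import Mathlib

/-- A `G`-family of quandles on a set `X` over a group `G`: a family of binary
operations `x ▷^g y = act g x y`, one for each `g ∈ G`, satisfying axioms
(iv), (v), (vi). -/
structure GFamily (G : Type*) [Group G] (X : Type*) where
  act : G → X → X → X
  idem : ∀ (g : G) (x : X), act g x x = x
  comp : ∀ (g h : G) (x y : X), act (g * h) x y = act h (act g x y) y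
  one : ∀ x y : X, act 1 x y = x
  distrib : ∀ (g h : G) (x y z : X),
    act h (act g x y) z = act (h⁻¹ * g * h) (act h x z) (act h y z)

/-- The operation of the associated quandle `A(G,X)` on `G × X`:
`(g,x) ▷ (h,y) = (h⁻¹gh, x ▷^h y)`. -/
def aqOp {G : Type*} [Group G] {X : Type*} (F : GFamily G X) :
    G × X → G × X → G × X :=
  fun p q => (q.1⁻¹ * p.1 * q.1, F.act q.1 p.2 q.2)

/-- The associated quandle operation on `G × X` is right self-distributive;
consequently `A(G,X)` is a quandle (idempotent, right-invertible and right
self-distributive). -/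
theorem aqOp_distrib_and_quandle {G : Type*} [Group G] {X : Type*}
    (F : GFamily G X) :
    (∀ a b c : G × X, aqOp F (aqOp F a b) c = aqOp F (aqOp F a c) (aqOp F b c)) ∧
    (∀ a : G × X, aqOp F a a = a) ∧
    (∀ b : G × X, Function.Bijective fun a : G × X => aqOp F a b) := by
  refine ⟨?_, ?_, ?_⟩
  · rintro ⟨g, x⟩ ⟨h, y⟩ ⟨k, z⟩
    refine Prod.ext ?_ ?_
    · simp only [aqOp]
      group
    · exact F.distrib h k x y z
  · rintro ⟨g, x⟩
    refine Prod.ext ?_ (F.idem g x)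
    simp [aqOp]
  · rintro ⟨h, y⟩
    refine Function.bijective_iff_has_inverse.mpr
      ⟨fun a => aqOp F a (h⁻¹, y), ?_, ?_⟩
    · rintro ⟨g, x⟩
      refine Prod.ext ?_ ?_
      · simp only [aqOp]
        group
      · simp only [aqOp]
        rw [← F.comp, mul_inv_cancel, F.one]
    · rintro ⟨g, x⟩
      refine Prod.ext ?_ ?_
      · simp only [aqOp]
        group
      · simp only [aqOp]
        rw [← F.comp, inv_mul_cancel, F.one]
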